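/- arXiv:2511.17815 — 3 statements merged into one kernel-verified Lean document; each statement's English description precedes it below -/
import Mathlib

section
/- Let q = p^ℓ with p > 3 prime and ℓ ≥ 1, and let f, g : 𝔽_q → 𝔽_q be planar functions with f ≠ g. Then there exist at least two distinct elements x_1, x_2 ∈ 𝔽_q such that f(x_1) ≠ g(x_1) and f(x_2) ≠ g(x_2); equivalently, the Hamming distance |{x ∈ 𝔽_q : f(x) ≠ g(x)}| is at least 2. -/
open Finset

/-- `f : 𝔽_q → 𝔽_q` is planar if for every `a ≠ 0` the difference operator
`Δ_{f,a}(x) = f(x+a) - f(x)` is a bijection of `𝔽_q`. -/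
def IsPlanar {F : Type*} [Field F] (f : F → F) : Prop :=
  ∀ a : F, a ≠ 0 → Function.Bijective (fun x => f (x + a) - f x)

/-- If two planar functions differ exactly at `z`, then the values at points symmetric
about `z` have constant sum. -/
theorem IsPlanar.add_eq_of_eq_off_point {F : Type*} [Field F] {f g : F → F}
    (hf : IsPlanar f) (hg : IsPlanar g) {z : F} (hz : f z ≠ g z)
    (hfg : ∀ x, x ≠ z → f x = g x) {a : F} (ha : a ≠ 0) :
    f (z + a) + f (z - a) = f z + g z := by
  obtain ⟨x, hx⟩ := (hg a ha).2 (f z - f (z - a))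
  dsimp only at hx
  by_cases hxz : x = z
  · subst hxz
    rw [← hfg (x + a) (by simpa using ha)] at hx
    linear_combination hx
  by_cases hxa : x + a = z
  · obtain rfl : x = z - a := eq_sub_of_add_eq hxa
    rw [← hfg _ hxz, hxa] at hx
    exact absurd (sub_left_injective hx).symm hz
  · rw [← hfg _ hxz, ← hfg _ hxa] at hx
    have h : x = z - a := (hf a ha).1 (by simpa using hx)
    exact absurd (by rw [h, sub_add_cancel]) hxa

theorem natCast_ne_zero_of_coprime_card {F : Type*} [Field F] [Fintype F] {n : ℕ}
    (hn : n.Coprime (Fintype.card F)) : (n : F) ≠ 0 := by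
  intro h
  have h₁ := (CharP.cast_eq_zero_iff F (ringChar F) n).1 h
  have h₂ := (CharP.cast_eq_zero_iff F (ringChar F) _).1 (Nat.cast_card_eq_zero F)
  exact CharP.ringChar_ne_one (Nat.eq_one_of_dvd_coprimes hn h₁ h₂)

/-- Two distinct planar functions over `𝔽_q`, `q = p^ℓ` with `p > 3` prime,
differ in at least two places: their Hamming distance is at least 2. -/
theorem planar_distance_ge_two {F : Type*} [Field F] [Fintype F] [DecidableEq F]
    (p ℓ : ℕ) (hp : p.Prime) (hp3 : 3 < p) (hℓ : 1 ≤ ℓ)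
    (hq : Fintype.card F = p ^ ℓ)
    (f g : F → F) (hf : IsPlanar f) (hg : IsPlanar g) (hfg : f ≠ g) :
    (∃ x₁ x₂ : F, x₁ ≠ x₂ ∧ f x₁ ≠ g x₁ ∧ f x₂ ≠ g x₂) ∧
      2 ≤ (Finset.univ.filter fun x : F => f x ≠ g x).card := by
  have hex : ∃ x₁ x₂ : F, x₁ ≠ x₂ ∧ f x₁ ≠ g x₁ ∧ f x₂ ≠ g x₂ := by
    obtain ⟨z, hz⟩ := Function.ne_iff.1 hfg
    by_contra! h
    have hoff : ∀ x, x ≠ z → f x = g x := fun x hx => h z x hx.symm hz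
    have h2 : (2 : F) ≠ 0 := by
      refine mod_cast natCast_ne_zero_of_coprime_card (n := 2) ?_
      rw [hq]
      exact ((Nat.coprime_primes Nat.prime_two hp).2 (by omega)).pow_right ℓ
    have h3 : (3 : F) ≠ 0 := by
      refine mod_cast natCast_ne_zero_of_coprime_card (n := 3) ?_
      rw [hq]
      exact ((Nat.coprime_primes Nat.prime_three hp).2 (by omega)).pow_right ℓ
    have e₁ := hf.add_eq_of_eq_off_point hg hz hoff one_ne_zero
    have e₂ := hf.add_eq_of_eq_off_point hg hz hoff h2
    have heq : z + 1 = z - 2 := by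
      refine (hf 1 one_ne_zero).1 ?_
      dsimp only
      rw [show z + 1 + 1 = z + 2 by ring, show z - 2 + 1 = z - 1 by ring]
      linear_combination e₂ - e₁
    exact h3 (by linear_combination heq)
  refine ⟨hex, ?_⟩
  obtain ⟨x₁, x₂, hne, h₁, h₂⟩ := hex
  exact Finset.one_lt_card.2 ⟨x₁, by simpa using h₁, x₂, by simpa using h₂, hne⟩
end

section
/- Let q be a power of a prime p, and let f, g : 𝔽_q → 𝔽_q be planar functions such that there is some w ∈ 𝔽_q with f(w) ≠ g(w) and f(x) = g(x) for all x ≠ w. Then for every a ∈ 𝔽_q with a ≠ 0, one has f(w+a) − f(w) = g(w) − g(w−a). -/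
open Finset

/-- If two planar functions agree everywhere except at a single point `w`,
then `f(w+a) - f(w) = g(w) - g(w-a)` for every `a ≠ 0`. -/
theorem planar_single_diff_identity {F : Type*} [Field F] [Fintype F]
    (p ℓ : ℕ) (hp : p.Prime) (hℓ : 1 ≤ ℓ) (hq : Fintype.card F = p ^ ℓ)
    (f g : F → F) (hf : IsPlanar f) (hg : IsPlanar g)
    (w : F) (hw : f w ≠ g w) (hagree : ∀ x : F, x ≠ w → f x = g x) :
    ∀ a : F, a ≠ 0 → f (w + a) - f w = g w - g (w - a) := by
  intro a ha
  obtain ⟨y, hy⟩ := (hg a ha).2 (f (w + a) - f w)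
  dsimp only at hy
  have hwa : f (w + a) = g (w + a) := hagree _ (by simpa using ha)
  by_cases h₁ : y = w
  · subst h₁
    rw [hwa] at hy
    exact absurd (sub_right_injective hy).symm hw
  by_cases h₂ : y + a = w
  · rw [← hy, h₂, ← h₂, add_sub_cancel_right]
  · rw [← hagree y h₁, ← hagree (y + a) h₂] at hy
    exact absurd ((hf a ha).1 hy) h₁
end

section
/- Let q be a power of a prime p, and let f, g : 𝔽_q → 𝔽_q be planar functions such that f(0) ≠ g(0), f(0) = 0, and f(x) = g(x) for all x ≠ 0. Then for every a ∈ 𝔽_q with a ≠ 0, one has f(a) + f(−a) = g(0). -/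
open Finset

/-- If two planar functions agree everywhere except at `0`, where `f(0) = 0`
and `f(0) ≠ g(0)`, then `f(a) + f(-a) = g(0)` for every `a ≠ 0`. -/
theorem planar_single_diff_sum_identity {F : Type*} [Field F] [Fintype F]
    (p ℓ : ℕ) (hp : p.Prime) (hℓ : 1 ≤ ℓ) (hq : Fintype.card F = p ^ ℓ)
    (f g : F → F) (hf : IsPlanar f) (hg : IsPlanar g)
    (hne : f 0 ≠ g 0) (hf0 : f 0 = 0)
    (hagree : ∀ x : F, x ≠ 0 → f x = g x) :
    ∀ a : F, a ≠ 0 → f a + f (-a) = g 0 := by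
  intro a ha
  obtain ⟨y, hy⟩ := (hg a ha).surjective (f a)
  simp only at hy
  by_cases hy0 : y = 0
  · subst hy0
    rw [zero_add, ← hagree a ha, sub_eq_self] at hy
    exact absurd (hf0.trans hy.symm) hne
  by_cases hya : y + a = 0
  · obtain rfl := eq_neg_of_add_eq_zero_left hya
    rw [hya, ← hagree (-a) hy0] at hy
    rw [← hy, sub_add_cancel]
  · rw [← hagree _ hya, ← hagree y hy0] at hy
    refine absurd ((hf a ha).injective (a₁ := y) (a₂ := 0) ?_) hy0
    simpa [hf0] using hy
end
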